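/- (Monotonicity of the gradient flow) Let P be the entrywise projection onto a set of index pairs, and let G, E ∈ ℝ^{n×n} with P E ≠ 0. Define κ = ⟨−G, P E⟩ / ‖P E‖² and Z = −P G − κ P E. Then ⟨G, Z⟩ = −‖P G‖² + ⟨P G, P E⟩² / ‖P E‖² ≤ 0. In particular, along any solution E(t) of the constrained gradient system Ė = −P G − κ P E with G the gradient of λ₂(Lap(W + εE)), the second smallest eigenvalue decreases monotonically. -/

import Mathlib

open Matrix BigOperators

/-- The graph Laplacian `Lap(Z) = diag(Z 𝟙) - Z`. -/
noncomputable def Lap {n : ℕ} (Z : Matrix (Fin n) (Fin n) ℝ) : Matrix (Fin n) (Fin n) ℝ :=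
  Matrix.diagonal (Z.mulVec fun _ => (1 : ℝ)) - Z

/-- The Frobenius inner product `⟨X, Y⟩ = trace(Xᵀ Y)`. -/
noncomputable def finner {n : ℕ} (X Y : Matrix (Fin n) (Fin n) ℝ) : ℝ :=
  (Xᵀ * Y).trace

/-- The entrywise projection onto the sparsity pattern `S`. -/
noncomputable def proj {n : ℕ} (S : Set (Fin n × Fin n)) (A : Matrix (Fin n) (Fin n) ℝ) :
    Matrix (Fin n) (Fin n) ℝ :=
  Matrix.of fun i j => S.indicator (fun p => A p.1 p.2) (i, j)

/-- The symmetric part `sym(A) = (A + Aᵀ)/2`. -/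
noncomputable def symPart {n : ℕ} (A : Matrix (Fin n) (Fin n) ℝ) : Matrix (Fin n) (Fin n) ℝ :=
  (2 : ℝ)⁻¹ • (A + Aᵀ)

theorem finner_eq_sum {n : ℕ} (X Y : Matrix (Fin n) (Fin n) ℝ) :
    finner X Y = ∑ i, ∑ j, X i j * Y i j := by
  rw [Finset.sum_comm]
  simp [finner, Matrix.trace, Matrix.mul_apply]

theorem finner_neg_left {n : ℕ} (X Y : Matrix (Fin n) (Fin n) ℝ) :
    finner (-X) Y = -finner X Y := by
  simp [finner]

theorem finner_neg_right {n : ℕ} (X Y : Matrix (Fin n) (Fin n) ℝ) :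
    finner X (-Y) = -finner X Y := by
  simp [finner]

theorem finner_sub_right {n : ℕ} (X Y Z : Matrix (Fin n) (Fin n) ℝ) :
    finner X (Y - Z) = finner X Y - finner X Z := by
  simp [finner, Matrix.mul_sub]

theorem finner_smul_right {n : ℕ} (c : ℝ) (X Y : Matrix (Fin n) (Fin n) ℝ) :
    finner X (c • Y) = c * finner X Y := by
  simp [finner]

theorem finner_sq_le {n : ℕ} (X Y : Matrix (Fin n) (Fin n) ℝ) :
    finner X Y ^ 2 ≤ finner X X * finner Y Y := by
  simp only [finner_eq_sum, ← Fintype.sum_prod_type', ← sq]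
  exact Finset.sum_mul_sq_le_sq_mul_sq _ _ _

theorem finner_self_pos {n : ℕ} {X : Matrix (Fin n) (Fin n) ℝ} (hX : X ≠ 0) :
    0 < finner X X := by
  have hnonneg : ∀ i j, 0 ≤ X i j * X i j := fun i j => mul_self_nonneg _
  obtain ⟨i, j, hij⟩ : ∃ i j, X i j ≠ 0 := by
    by_contra! h
    exact hX (Matrix.ext h)
  rw [finner_eq_sum]
  exact Finset.sum_pos' (fun i _ => Finset.sum_nonneg fun j _ => hnonneg i j)
    ⟨i, Finset.mem_univ _, Finset.sum_pos' (fun j _ => hnonneg i j)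
      ⟨j, Finset.mem_univ _, mul_self_pos.mpr hij⟩⟩

theorem finner_proj_left {n : ℕ} (S : Set (Fin n × Fin n)) (A B : Matrix (Fin n) (Fin n) ℝ) :
    finner (proj S A) B = finner A (proj S B) := by
  classical
  simp [finner_eq_sum, proj, Set.indicator_apply]

theorem proj_proj {n : ℕ} (S : Set (Fin n × Fin n)) (A : Matrix (Fin n) (Fin n) ℝ) :
    proj S (proj S A) = proj S A := by
  classical
  ext i j
  by_cases h : (i, j) ∈ S <;> simp [proj, h]

theorem finner_flow_direction {n : ℕ} (S : Set (Fin n × Fin n))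
    (G E : Matrix (Fin n) (Fin n) ℝ) :
    finner G (-(proj S G) - (finner (-G) (proj S E) / finner (proj S E) (proj S E)) • proj S E) =
      -(finner (proj S G) (proj S G)) +
        (finner (proj S G) (proj S E)) ^ 2 / finner (proj S E) (proj S E) := by
  have h : ∀ A, finner G (proj S A) = finner (proj S G) (proj S A) := fun A => by
    rw [finner_proj_left, proj_proj]
  rw [finner_sub_right, finner_neg_right, finner_smul_right, finner_neg_left, h, h]
  ring

theorem finner_flow_direction_nonpos {n : ℕ} (S : Set (Fin n × Fin n))
    (G E : Matrix (Fin n) (Fin n) ℝ) (hE : proj S E ≠ 0) :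
    finner G (-(proj S G) - (finner (-G) (proj S E) / finner (proj S E) (proj S E)) • proj S E) ≤
      0 := by
  rw [finner_flow_direction]
  have := (div_le_iff₀ (finner_self_pos hE)).mpr (finner_sq_le (proj S G) (proj S E))
  linarith

theorem Lap_mulVec_apply {n : ℕ} (M : Matrix (Fin n) (Fin n) ℝ) (x : Fin n → ℝ) (i : Fin n) :
    (Lap M).mulVec x i = ∑ j, M i j * (x i - x j) := by
  rw [Lap, Matrix.sub_mulVec, Pi.sub_apply, Matrix.mulVec_diagonal]
  simp [Matrix.mulVec, dotProduct, mul_sub, Finset.sum_mul]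

/-- The derivative of a differentiable eigenvalue branch of the Laplacian along a path of symmetric
matrices. -/
theorem deriv_eigenvalue_Lap {n : ℕ} {M M' : ℝ → Matrix (Fin n) (Fin n) ℝ}
    {lam lam' : ℝ → ℝ} {x x' : ℝ → Fin n → ℝ}
    (hM : ∀ t, (M t).IsSymm)
    (hM' : ∀ t i j, HasDerivAt (fun s => M s i j) (M' t i j) t)
    (hlam : ∀ t, HasDerivAt lam (lam' t) t)
    (hx : ∀ t i, HasDerivAt (fun s => x s i) (x' t i) t)
    (heig : ∀ t, (Lap (M t)).mulVec (x t) = lam t • x t)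
    (hxnorm : ∀ t, ∑ i, x t i ^ 2 = 1) (t : ℝ) :
    lam' t = ∑ i, ∑ j, M' t i j * (x t i * (x t i - x t j)) := by
  have heig' : ∀ s i, ∑ j, M s i j * (x s i - x s j) = lam s * x s i := fun s i => by
    rw [← Lap_mulVec_apply, heig]
    rfl
  have hray : lam = fun s => ∑ i, ∑ j, M s i j * (x s i * (x s i - x s j)) := by
    funext s
    calc lam s = lam s * ∑ i, x s i ^ 2 := by rw [hxnorm, mul_one]
      _ = ∑ i, x s i * ∑ j, M s i j * (x s i - x s j) := by
        simp only [heig', Finset.mul_sum]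
        exact Finset.sum_congr rfl fun i _ => by ring
      _ = _ := by
        simp only [Finset.mul_sum]
        exact Finset.sum_congr rfl fun i _ => Finset.sum_congr rfl fun j _ => by ring
  have horth : ∑ i, x' t i * x t i = 0 := by
    have hd : HasDerivAt (fun s => ∑ i, x s i ^ 2) (∑ i, 2 * (x' t i * x t i)) t :=
      HasDerivAt.fun_sum fun i _ => ((hx t i).fun_pow 2).congr_deriv (by push_cast; ring)
    have h0 := hd.unique
      ((hasDerivAt_const t (1 : ℝ)).congr_of_eventuallyEq (.of_forall hxnorm))
    rw [← Finset.mul_sum] at h0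
    linarith
  have hd : HasDerivAt lam (∑ i, ∑ j, (M' t i j * (x t i * (x t i - x t j)) +
      M t i j * (x' t i * (x t i - x t j) + x t i * (x' t i - x' t j)))) t := by
    rw [hray]
    exact HasDerivAt.fun_sum fun i _ => HasDerivAt.fun_sum fun j _ =>
      (hM' t i j).fun_mul ((hx t i).fun_mul ((hx t i).fun_sub (hx t j)))
  have hswap : ∑ i, ∑ j, M t i j * (x t i * x' t j) = ∑ i, ∑ j, M t i j * (x' t i * x t j) := by
    rw [Finset.sum_comm]
    exact Finset.sum_congr rfl fun i _ => Finset.sum_congr rfl fun j _ => by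
      rw [(hM t).apply i j, mul_comm (x t j)]
  have hfirst : ∑ i, ∑ j, M t i j * (x' t i * (x t i - x t j)) = 0 := by
    calc _ = ∑ i, x' t i * ∑ j, M t i j * (x t i - x t j) := by
          simp only [Finset.mul_sum]
          exact Finset.sum_congr rfl fun i _ => Finset.sum_congr rfl fun j _ => by ring
      _ = lam t * ∑ i, x' t i * x t i := by
          simp only [heig', Finset.mul_sum]
          exact Finset.sum_congr rfl fun i _ => by ring
      _ = 0 := by rw [horth, mul_zero]
  have hsecond : ∑ i, ∑ j, M t i j * (x t i * (x' t i - x' t j)) = 0 := by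
    rw [← hfirst]
    simp only [mul_sub, Finset.sum_sub_distrib, hswap]
    simp only [mul_comm (x t _) (x' t _)]
  rw [(hlam t).unique hd]
  simp only [mul_add, Finset.sum_add_distrib, hfirst, hsecond, add_zero]

theorem finner_gradient {n : ℕ} {E : Set (Fin n × Fin n)} {D : Matrix (Fin n) (Fin n) ℝ}
    (hD : D.IsSymm) (hDE : proj E D = D) (x : Fin n → ℝ) :
    finner (proj E (symPart (vecMulVec (fun i => x i ^ 2) fun _ => (1 : ℝ)) - vecMulVec x x)) D =
      ∑ i, ∑ j, D i j * (x i * (x i - x j)) := by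
  have hswap : ∑ i, ∑ j, D i j * x j ^ 2 = ∑ i, ∑ j, D i j * x i ^ 2 := by
    rw [Finset.sum_comm]
    exact Finset.sum_congr rfl fun i _ => Finset.sum_congr rfl fun j _ => by rw [hD.apply i j]
  rw [finner_proj_left, hDE, finner_eq_sum]
  calc _ = ∑ i, ∑ j, (D i j * (x i * (x i - x j)) +
        2⁻¹ * (D i j * x j ^ 2 - D i j * x i ^ 2)) :=
        Finset.sum_congr rfl fun i _ => Finset.sum_congr rfl fun j _ => by
          simp only [symPart, Matrix.sub_apply, Matrix.smul_apply, Matrix.add_apply,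
            Matrix.transpose_apply, vecMulVec_apply, smul_eq_mul]
          ring
    _ = _ := by
        simp only [Finset.sum_add_distrib, ← Finset.mul_sum, Finset.sum_sub_distrib, hswap,
          sub_self, mul_zero, add_zero]

/-- **monotonicity of the gradient flow.** For any `G, E` with `P E ≠ 0`,
setting `κ = ⟨-G, P E⟩/‖P E‖²` and `Z = -P G - κ P E`, one has
`⟨G, Z⟩ = -‖P G‖² + ⟨P G, P E⟩²/‖P E‖² ≤ 0`. In particular, along any solution `E(t)` of the
constrained gradient system `Ė = -P G - κ P E`, where `G` is the gradient of
`λ₂(Lap(W + ε E))`, the second smallest eigenvalue decreases monotonically: `λ̇(t) ≤ 0`. -/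
theorem gradient_flow_monotonicity {n : ℕ}
    (S : Set (Fin n × Fin n))
    (W : Matrix (Fin n) (Fin n) ℝ) (hW : W.IsSymm)
    (E : Set (Fin n × Fin n)) (hEsymset : ∀ i j, (i, j) ∈ E → (j, i) ∈ E)
    (ε : ℝ) (hε : 0 < ε)
    (Epath E' : ℝ → Matrix (Fin n) (Fin n) ℝ)
    (hEsym : ∀ t, (Epath t).IsSymm)
    (hEsp : ∀ t, proj E (Epath t) = Epath t)
    (hE' : ∀ t i j, HasDerivAt (fun s => Epath s i j) (E' t i j) t)
    (lam lam' : ℝ → ℝ) (x x' : ℝ → Fin n → ℝ)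
    (hlam : ∀ t, HasDerivAt lam (lam' t) t)
    (hx : ∀ t i, HasDerivAt (fun s => x s i) (x' t i) t)
    (heig : ∀ t, (Lap (W + ε • Epath t)).mulVec (x t) = lam t • x t)
    (hxnorm : ∀ t, ∑ i, x t i ^ 2 = 1)
    (G : ℝ → Matrix (Fin n) (Fin n) ℝ)
    (hG : ∀ t, G t = proj E (symPart (vecMulVec (fun i => x t i ^ 2) fun _ => (1 : ℝ)) -
      vecMulVec (x t) (x t)))
    (hPEpath : ∀ t, proj S (Epath t) ≠ 0)
    (hflow : ∀ t, E' t = -(proj S (G t)) -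
      (finner (-(G t)) (proj S (Epath t)) / finner (proj S (Epath t)) (proj S (Epath t))) •
        proj S (Epath t)) :
    (∀ G₀ E₀ : Matrix (Fin n) (Fin n) ℝ, proj S E₀ ≠ 0 →
      finner G₀
          (-(proj S G₀) -
            (finner (-G₀) (proj S E₀) / finner (proj S E₀) (proj S E₀)) • proj S E₀) =
        -(finner (proj S G₀) (proj S G₀)) +
          (finner (proj S G₀) (proj S E₀)) ^ 2 / finner (proj S E₀) (proj S E₀) ∧
      finner G₀
          (-(proj S G₀) -
            (finner (-G₀) (proj S E₀) / finner (proj S E₀) (proj S E₀)) • proj S E₀) ≤ 0) ∧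
    (∀ t, lam' t ≤ 0) := by
  refine ⟨fun G₀ E₀ h => ⟨finner_flow_direction S G₀ E₀, finner_flow_direction_nonpos S G₀ E₀ h⟩,
    fun t => ?_⟩
  have hE'sym : (E' t).IsSymm := Matrix.IsSymm.ext fun i j =>
    (hE' t j i).unique ((hE' t i j).congr_of_eventuallyEq
      (.of_forall fun s => (hEsym s).apply i j))
  have hE'sp : proj E (E' t) = E' t := by
    ext i j
    by_cases h : (i, j) ∈ E
    · simp [proj, h]
    · have h0 : ∀ s, Epath s i j = 0 := fun s => by
        rw [← hEsp s]
        simp [proj, h]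
      have := (hE' t i j).unique
        ((hasDerivAt_const t (0 : ℝ)).congr_of_eventuallyEq (.of_forall h0))
      simp [proj, h, this]
  have hderiv := deriv_eigenvalue_Lap (M := fun s => W + ε • Epath s) (M' := fun s => ε • E' s)
    (fun s => hW.add ((hEsym s).smul ε))
    (fun s i j => ((hE' s i j).const_mul ε).const_add (W i j)) hlam hx heig hxnorm t
  have hgrad : lam' t = ε * finner (G t) (E' t) := by
    rw [hG, finner_gradient hE'sym hE'sp, hderiv]
    simp only [Matrix.smul_apply, smul_eq_mul, Finset.mul_sum, mul_assoc]
  rw [hgrad, hflow t]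
  exact mul_nonpos_of_nonneg_of_nonpos hε.le
    (finner_flow_direction_nonpos S (G t) (Epath t) (hPEpath t))
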